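/- Let μ be a Radon measure on ℍⁿ such that 0 < liminf_{r→0} μ(B(p,r))/r^s ≤ limsup_{r→0} μ(B(p,r))/r^s < ∞ for μ-a.e. p. Then for μ-a.e. a ∈ ℍⁿ: (i) 0 ∈ supp ν for every ν ∈ Tan(μ,a), and (ii) every sequence r_k → 0⁺ has a subsequence (r_{k_i}) such that c·lim_i r_{k_i}^{-s}(T_{a,r_{k_i}})_#μ exists and is a tangent measure of μ at a for some c > 0. -/

import Mathlib

open Filter Topology MeasureTheory
open scoped BigOperators ENNReal RealInnerProductSpace

noncomputable section

/-- The Heisenberg group `ℍⁿ`, identified with `ℝ^{2n} × ℝ`; the horizontal part is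
`EuclideanSpace ℝ (Fin n ⊕ Fin n)` where index `Sum.inl i` corresponds to coordinate `i`
(`1 ≤ i ≤ n` in the paper) and `Sum.inr i` to coordinate `n + i`. -/
abbrev H (n : ℕ) := EuclideanSpace ℝ (Fin n ⊕ Fin n) × ℝ

/-- `A(p,q) = -2 ∑ (p_i q_{n+i} - p_{n+i} q_i)`. -/
def A {n : ℕ} (p q : H n) : ℝ :=
  -2 * ∑ i : Fin n, (p.1 (Sum.inl i) * q.1 (Sum.inr i) - p.1 (Sum.inr i) * q.1 (Sum.inl i))

/-- The Heisenberg group operation. -/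
def Hmul {n : ℕ} (p q : H n) : H n := (p.1 + q.1, p.2 + q.2 + A p q)

/-- The Heisenberg inverse `p⁻¹ = -p`. -/
def Hinv {n : ℕ} (p : H n) : H n := (-p.1, -p.2)

/-- The dilations `δ_r`. -/
def dil {n : ℕ} (r : ℝ) (p : H n) : H n := (r • p.1, r ^ 2 * p.2)

/-- The Korányi Kgauge. -/
def Kgauge {n : ℕ} (p : H n) : ℝ := (‖p.1‖ ^ 4 + p.2 ^ 2) ^ ((1 : ℝ) / 4)

/-- The Korányi metric `d(p,q) = ‖p⁻¹·q‖`. -/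
def hdist {n : ℕ} (p q : H n) : ℝ := Kgauge (Hmul (Hinv p) q)

/-- Closed balls in the Korányi metric. -/
def Kball {n : ℕ} (p : H n) (r : ℝ) : Set (H n) := {q | hdist p q ≤ r}

/-- The support of a measure: points all of whose Korányi balls have positive measure. -/
def msupport {n : ℕ} (μ : Measure (H n)) : Set (H n) :=
  {x | ∀ r : ℝ, 0 < r → 0 < μ (Kball x r)}

/-- The diameter of a set in the Korányi metric. -/
def hdiam {n : ℕ} (S : Set (H n)) : ℝ :=
  sSup {t | ∃ p ∈ S, ∃ q ∈ S, t = hdist p q}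

/-- `s`-Ahlfors–David regularity: `r^s/C ≤ μ(B(x,r)) ≤ C r^s` for `x ∈ spt μ` and
`0 < r < diam (spt μ)`. -/
def IsADRegular {n : ℕ} (s : ℝ) (μ : Measure (H n)) : Prop :=
  ∃ C : ℝ, 0 < C ∧ ∀ x ∈ msupport μ, ∀ r : ℝ, 0 < r → r < hdiam (msupport μ) →
    ENNReal.ofReal (r ^ s / C) ≤ μ (Kball x r) ∧ μ (Kball x r) ≤ ENNReal.ofReal (C * r ^ s)

/-- Weak convergence of a sequence of measures, tested against continuous compactly
supported functions. -/
def WeakTendsto {n : ℕ} (μs : ℕ → Measure (H n)) (ν : Measure (H n)) : Prop :=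
  ∀ f : H n → ℝ, Continuous f → HasCompactSupport f →
    Tendsto (fun i => ∫ x, f x ∂(μs i)) atTop (𝓝 (∫ x, f x ∂ν))

/-- `T_{a,r}(p) = δ_{1/r}(a⁻¹·p)`. -/
def Tmap {n : ℕ} (a : H n) (r : ℝ) (p : H n) : H n := dil (1 / r) (Hmul (Hinv a) p)

/-- `ν` is a tangent measure of `μ` at `a`. -/
def IsTangent {n : ℕ} (μ : Measure (H n)) (a : H n) (ν : Measure (H n)) : Prop :=
  ν ≠ 0 ∧ IsFiniteMeasureOnCompacts ν ∧
    ∃ c r : ℕ → ℝ, (∀ i, 0 < c i) ∧ (∀ i, 0 < r i) ∧ Tendsto r atTop (𝓝 0) ∧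
      WeakTendsto (fun i => ENNReal.ofReal (c i) • Measure.map (Tmap a (r i)) μ) ν

section Helpers

theorem vague_compactness {X : Type*} [MetricSpace X] [ProperSpace X] [MeasurableSpace X]
    [BorelSpace X] (x0 : X) (μ : ℕ → Measure X) [∀ k, IsFiniteMeasureOnCompacts (μ k)]
    (hb : ∀ m : ℕ, ∃ M : ℝ, ∀ k, (μ k).real (Metric.closedBall x0 m) ≤ M) :
    ∃ φ : ℕ → ℕ, StrictMono φ ∧ ∃ ν : Measure X, IsFiniteMeasureOnCompacts ν ∧
      ∀ f : X → ℝ, Continuous f → HasCompactSupport f →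
        Tendsto (fun i => ∫ x, f x ∂(μ (φ i))) atTop (𝓝 (∫ x, f x ∂ν)) := by
  classical
  choose M hM using hb
  let E : ℕ → Set C(X, ℝ) := fun m => {f : C(X, ℝ) | ∀ x, x ∉ Metric.closedBall x0 (m : ℝ) → f x = 0}
  have hne : ∀ m, Nonempty (E m) := fun m => ⟨⟨0, fun x _ => rfl⟩⟩
  have hsep : ∀ m, TopologicalSpace.SeparableSpace (E m) := fun m => by
    infer_instance
  have hcs : ∀ m (f : E m), HasCompactSupport (f.1 : X → ℝ) := fun m f =>
    HasCompactSupport.intro (isCompact_closedBall x0 (m : ℝ)) f.2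
  have hint : ∀ m (f : E m) k, Integrable (f.1 : X → ℝ) (μ k) := fun m f k =>
    f.1.continuous.integrable_of_hasCompactSupport (hcs m f)
  -- key estimate
  have hest : ∀ (m : ℕ) (g : X → ℝ), (∀ x, x ∉ Metric.closedBall x0 (m : ℝ) → g x = 0) →
      ∀ C : ℝ, 0 ≤ C → (∀ x ∈ Metric.closedBall x0 (m : ℝ), ‖g x‖ ≤ C) → ∀ k,
      ‖∫ x, g x ∂(μ k)‖ ≤ C * M m := by
    intro m g hg C hC0 hC k
    rw [← setIntegral_eq_integral_of_forall_compl_eq_zero (s := Metric.closedBall x0 (m : ℝ)) hg]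
    have h1 := norm_setIntegral_le_of_norm_le_const (μ := μ k)
      (isCompact_closedBall x0 (m : ℝ)).measure_lt_top hC
    exact h1.trans (mul_le_mul_of_nonneg_left (hM m k) hC0)
  let D : ℕ × ℕ → C(X, ℝ) := fun p => (TopologicalSpace.denseSeq (E p.1) p.2).1
  have hbd : ∀ p : ℕ × ℕ, ∃ B : ℝ, ∀ k, ‖∫ x, D p x ∂(μ k)‖ ≤ B := by
    intro p
    obtain ⟨C, hC⟩ := (isCompact_closedBall x0 (p.1 : ℝ)).exists_bound_of_continuousOn
      (D p).continuous.continuousOn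
    exact ⟨_, hest p.1 (D p) (TopologicalSpace.denseSeq (E p.1) p.2).2 (max C 0)
      (le_max_right _ _) (fun x hx => (hC x hx).trans (le_max_left _ _))⟩
  choose B hB using hbd
  obtain ⟨l, -, φ, hφ, hl⟩ := (isCompact_univ_pi
    (fun p : ℕ × ℕ => isCompact_closedBall (0 : ℝ) (B p))).tendsto_subseq
    (x := fun k p => ∫ x, D p x ∂(μ k)) (fun k p _ => by simpa using hB p k)
  rw [tendsto_pi_nhds] at hl
  have hconv : ∀ m (f : E m), ∃ L : ℝ, Tendsto (fun i => ∫ x, f.1 x ∂(μ (φ i))) atTop (𝓝 L) := by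
    intro m f
    apply cauchySeq_tendsto_of_complete
    rw [Metric.cauchySeq_iff']
    intro ε hε
    have hM0 : 0 ≤ M m := le_trans measureReal_nonneg (hM m 0)
    obtain ⟨δ, hδ, hδM⟩ : ∃ δ > 0, δ * M m < ε / 3 := by
      refine ⟨ε / 3 / (M m + 1), by positivity, ?_⟩
      rw [div_mul_eq_mul_div, div_lt_iff₀ (by positivity)]
      nlinarith
    obtain ⟨j, hj⟩ : ∃ j, ∀ x ∈ Metric.closedBall x0 (m : ℝ),
        ‖f.1 x - D (m, j) x‖ ≤ δ := by
      have hd := TopologicalSpace.denseRange_denseSeq (E m) f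
      rw [mem_closure_iff_seq_limit] at hd
      obtain ⟨u, hu, hul⟩ := hd
      have h2 := (continuous_subtype_val.tendsto f).comp hul
      rw [ContinuousMap.tendsto_iff_forall_isCompact_tendstoUniformlyOn] at h2
      have h3 := h2 _ (isCompact_closedBall x0 (m : ℝ))
      rw [Metric.tendstoUniformlyOn_iff] at h3
      obtain ⟨i, hi⟩ := (h3 δ hδ).exists
      obtain ⟨j, hj⟩ := hu i
      refine ⟨j, fun x hx => ?_⟩
      have := hi x hx
      simp only [Function.comp, ← hj, dist_eq_norm] at this
      exact this.le
    have hcl : ∀ k, |∫ x, f.1 x ∂(μ k) - ∫ x, D (m, j) x ∂(μ k)| < ε / 3 := by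
      intro k
      rw [← integral_sub (hint m f k) (hint m (TopologicalSpace.denseSeq (E m) j) k)]
      refine lt_of_le_of_lt (hest m _ (fun x hx => ?_) δ hδ.le hj k) hδM
      show f.1 x - (TopologicalSpace.denseSeq (E m) j).1 x = 0
      rw [f.2 x hx, (TopologicalSpace.denseSeq (E m) j).2 x hx, sub_zero]
    obtain ⟨N, hN⟩ := Metric.cauchySeq_iff'.1 (hl (m, j)).cauchySeq (ε / 3) (by positivity)
    refine ⟨N, fun i hi => ?_⟩
    have h1 := hN i hi
    have h2 := hcl (φ i)
    have h3 := hcl (φ N)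
    simp only [Function.comp, Real.dist_eq] at h1 ⊢
    rw [abs_lt] at *
    constructor <;> linarith [h1.1, h1.2, h2.1, h2.2, h3.1, h3.2]
  have hconv' : ∀ f : CompactlySupportedContinuousMap X ℝ,
      ∃ L : ℝ, Tendsto (fun i => ∫ x, f x ∂(μ (φ i))) atTop (𝓝 L) := by
    intro f
    obtain ⟨R, hR⟩ := f.hasCompactSupport'.isBounded.subset_closedBall x0
    obtain ⟨m, hm⟩ := exists_nat_ge R
    refine hconv m ⟨f.toContinuousMap, fun x hx => ?_⟩
    by_contra h
    exact hx (Metric.closedBall_subset_closedBall hm (hR (subset_tsupport _ h)))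
  choose Λ hΛ using hconv'
  have hi : ∀ (f : CompactlySupportedContinuousMap X ℝ) k, Integrable f (μ k) := fun f k =>
    f.continuous.integrable_of_hasCompactSupport f.hasCompactSupport'
  let Λl : CompactlySupportedContinuousMap X ℝ →ₗ[ℝ] ℝ :=
    { toFun := Λ
      map_add' := fun f g => by
        refine tendsto_nhds_unique (hΛ (f + g)) (((hΛ f).add (hΛ g)).congr fun i => ?_)
        rw [← integral_add (hi f _) (hi g _)]
        rfl
      map_smul' := fun c f => by
        refine tendsto_nhds_unique (hΛ (c • f)) (((hΛ f).const_mul c).congr fun i => ?_)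
        rw [← integral_const_mul]
        rfl }
  let Λp : CompactlySupportedContinuousMap X ℝ →ₚ[ℝ] ℝ := PositiveLinearMap.mk₀ Λl (fun f hf =>
    ge_of_tendsto' (hΛ f) (fun i => integral_nonneg hf))
  refine ⟨φ, hφ, RealRMK.rieszMeasure Λp, inferInstance, fun f hf hfc => ?_⟩
  have h := RealRMK.integral_rieszMeasure Λp ⟨⟨f, hf⟩, hfc⟩
  have h' := hΛ ⟨⟨f, hf⟩, hfc⟩
  change ∫ x, f x ∂_ = Λ _ at h
  rw [h]
  exact h'

variable {n : ℕ}

theorem A_cont_right (a : H n) : Continuous (fun p : H n => A a p) := by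
  unfold A; fun_prop

theorem Hmul_cont (a : H n) : Continuous (fun p : H n => Hmul a p) := by
  have := A_cont_right a
  unfold Hmul; fun_prop

theorem dil_cont (r : ℝ) : Continuous (fun p : H n => dil r p) := by
  unfold dil; fun_prop

theorem Tmap_cont (a : H n) (r : ℝ) : Continuous (Tmap a r) :=
  (dil_cont (1 / r)).comp (Hmul_cont (Hinv a))

theorem Kgauge_cont : Continuous (fun p : H n => Kgauge p) := by
  unfold Kgauge
  exact Continuous.rpow_const (by fun_prop) (fun _ => Or.inr (by norm_num))

theorem Kgauge_nonneg (p : H n) : 0 ≤ Kgauge p := by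
  unfold Kgauge; positivity

theorem Kgauge_pow (p : H n) : Kgauge p ^ 4 = ‖p.1‖ ^ 4 + p.2 ^ 2 := by
  unfold Kgauge
  rw [← Real.rpow_natCast, ← Real.rpow_mul (by positivity)]
  norm_num

theorem Kgauge_dil {r : ℝ} (hr : 0 < r) (p : H n) : Kgauge (dil r p) = r * Kgauge p := by
  have h1 := Kgauge_nonneg p
  have h2 := Kgauge_nonneg (dil r p)
  refine (pow_left_inj₀ h2 (by positivity) (n := 4) (by norm_num)).1 ?_
  rw [mul_pow, Kgauge_pow, Kgauge_pow]
  simp only [dil, norm_smul, Real.norm_eq_abs, abs_of_pos hr]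
  ring

theorem hdist_zero (p : H n) : hdist 0 p = Kgauge p := by
  unfold hdist Hmul Hinv A
  simp

theorem mem_Kball_zero {p : H n} {r : ℝ} : p ∈ Kball (0 : H n) r ↔ Kgauge p ≤ r := by
  show hdist 0 p ≤ r ↔ _
  rw [hdist_zero]

theorem Tmap_preimage (a : H n) {r : ℝ} (hr : 0 < r) (R : ℝ) :
    Tmap a r ⁻¹' (Kball 0 R) = Kball a (R * r) := by
  ext p
  rw [Set.mem_preimage, mem_Kball_zero, Tmap, Kgauge_dil (by positivity)]
  show _ ↔ Kgauge (Hmul (Hinv a) p) ≤ R * r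
  rw [one_div, inv_mul_le_iff₀ hr, mul_comm]

theorem Kball_zero_closed (R : ℝ) : IsClosed (Kball (0 : H n) R) := by
  have : Kball (0 : H n) R = {p | Kgauge p ≤ R} := by
    ext p; exact mem_Kball_zero
  rw [this]
  exact isClosed_le Kgauge_cont continuous_const

theorem Kball_zero_compact (R : ℝ) : IsCompact (Kball (0 : H n) R) := by
  refine ((isCompact_closedBall (0 : EuclideanSpace ℝ (Fin n ⊕ Fin n)) |R|).prod
    (isCompact_closedBall (0 : ℝ) (|R| ^ 2))).of_isClosed_subset (Kball_zero_closed R) ?_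
  intro p hp
  rw [mem_Kball_zero] at hp
  have hp' : Kgauge p ≤ |R| := hp.trans (le_abs_self R)
  have h1 := pow_le_pow_left₀ (Kgauge_nonneg p) hp' 4
  rw [Kgauge_pow] at h1
  refine ⟨?_, ?_⟩
  · rw [mem_closedBall_zero_iff]
    refine (pow_le_pow_iff_left₀ (norm_nonneg _) (abs_nonneg R) (n := 4) (by norm_num)).1 ?_
    nlinarith [sq_nonneg p.2]
  · rw [mem_closedBall_zero_iff, Real.norm_eq_abs]
    refine (pow_le_pow_iff_left₀ (abs_nonneg _) (by positivity) (n := 2) (by norm_num)).1 ?_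
    rw [sq_abs, ← pow_mul]
    have h2 : 0 ≤ ‖p.1‖ ^ 4 := by positivity
    norm_num only
    linarith

theorem Hmul_Hinv (a p : H n) : Hmul a (Hmul (Hinv a) p) = p := by
  unfold Hmul Hinv
  refine Prod.ext (by simp) ?_
  have : A a (-a.1 + p.1, -a.2 + p.2 + A (-a.1, -a.2) p) = - A (-a.1, -a.2) p := by
    unfold A
    simp only [mul_neg, neg_mul, neg_neg, PiLp.add_apply, PiLp.neg_apply, neg_inj,
      Finset.mul_sum, ← Finset.sum_neg_distrib]
    refine Finset.sum_congr rfl fun i _ => ?_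
    ring
  simp only [this]
  ring

theorem Kball_compact (a : H n) (R : ℝ) : IsCompact (Kball a R) := by
  have h : Kball a R = (fun p => Hmul (Hinv a) p) ⁻¹' (Kball 0 R) := by
    ext p
    rw [Set.mem_preimage, mem_Kball_zero]
    rfl
  refine ((Kball_zero_compact R).image (Hmul_cont a)).of_isClosed_subset ?_ ?_
  · rw [h]; exact (Kball_zero_closed R).preimage (Hmul_cont _)
  · intro p hp
    rw [h] at hp
    exact ⟨_, hp, Hmul_Hinv a p⟩

theorem compact_subset_Kball {K : Set (H n)} (hK : IsCompact K) : ∃ R, K ⊆ Kball 0 R := by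
  obtain ⟨C, hC⟩ := hK.exists_bound_of_continuousOn Kgauge_cont.continuousOn
  exact ⟨C, fun p hp => mem_Kball_zero.2 ((le_abs_self _).trans (hC p hp))⟩

/-- The rescaled measure. -/
def resc (μ : Measure (H n)) (a : H n) (c r : ℝ) : Measure (H n) :=
  ENNReal.ofReal c • Measure.map (Tmap a r) μ

theorem resc_Kball (μ : Measure (H n)) (a : H n) {c r : ℝ} (hr : 0 < r) (R : ℝ) :
    resc μ a c r (Kball 0 R) = ENNReal.ofReal c * μ (Kball a (R * r)) := by
  rw [resc, Measure.smul_apply, Measure.map_apply (Tmap_cont a r).measurable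
    (Kball_zero_closed R).measurableSet, Tmap_preimage a hr, smul_eq_mul]

theorem resc_Kball_real (μ : Measure (H n)) (a : H n) {c r : ℝ} (hc : 0 ≤ c) (hr : 0 < r) (R : ℝ) :
    (resc μ a c r).real (Kball 0 R) = c * μ.real (Kball a (R * r)) := by
  rw [measureReal_def, resc_Kball μ a hr, ENNReal.toReal_mul, ENNReal.toReal_ofReal hc,
    measureReal_def]

theorem resc_fin (μ : Measure (H n)) [IsFiniteMeasureOnCompacts μ] (a : H n) {c r : ℝ}
    (hr : 0 < r) : IsFiniteMeasureOnCompacts (resc μ a c r) := by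
  refine ⟨fun K hK => ?_⟩
  obtain ⟨R, hR⟩ := compact_subset_Kball hK
  refine (measure_mono hR).trans_lt ?_
  rw [resc_Kball μ a hr]
  exact ENNReal.mul_lt_top ENNReal.ofReal_lt_top (Kball_compact a _).measure_lt_top

/-- Cutoff function. -/
def bump (ρ : ℝ) (p : H n) : ℝ := max 0 (min 1 (2 - Kgauge p * (2 / ρ)))

theorem bump_cont (ρ : ℝ) : Continuous (bump ρ : H n → ℝ) := by
  have := Kgauge_cont (n := n)
  unfold bump; fun_prop

theorem bump_supp {ρ : ℝ} (hρ : 0 < ρ) (p : H n) (hp : p ∉ Kball 0 ρ) : bump ρ p = 0 := by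
  rw [mem_Kball_zero, not_le] at hp
  refine max_eq_left ((min_le_right _ _).trans ?_)
  have : 1 ≤ Kgauge p / ρ := (one_le_div hρ).2 hp.le
  have h2 : Kgauge p * (2 / ρ) = 2 * (Kgauge p / ρ) := by ring
  linarith

theorem bump_comp {ρ : ℝ} (hρ : 0 < ρ) : HasCompactSupport (bump ρ : H n → ℝ) :=
  HasCompactSupport.intro (Kball_zero_compact ρ) (bump_supp hρ)

theorem bump_one {ρ : ℝ} (hρ : 0 < ρ) (p : H n) (hp : p ∈ Kball 0 (ρ / 2)) : bump ρ p = 1 := by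
  rw [mem_Kball_zero] at hp
  have h2 : Kgauge p * (2 / ρ) ≤ 1 := by
    rw [mul_div_assoc', div_le_one hρ]; linarith
  unfold bump
  rw [min_eq_left (by linarith)]; norm_num

theorem bump_nonneg (ρ : ℝ) (p : H n) : 0 ≤ bump ρ p := le_max_left _ _

theorem bump_le_one (ρ : ℝ) (p : H n) : bump ρ p ≤ 1 :=
  max_le zero_le_one (min_le_left _ _)

theorem bump_bounds (ν : Measure (H n)) [IsFiniteMeasureOnCompacts ν] {ρ : ℝ} (hρ : 0 < ρ) :
    ν.real (Kball 0 (ρ / 2)) ≤ ∫ x, bump ρ x ∂ν ∧ ∫ x, bump ρ x ∂ν ≤ ν.real (Kball 0 ρ) := by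
  have hi : Integrable (bump ρ) ν := (bump_cont ρ).integrable_of_hasCompactSupport (bump_comp hρ)
  have hI : ∀ R, Integrable ((Kball (0 : H n) R).indicator (1 : H n → ℝ)) ν := fun R =>
    (integrable_indicator_iff (Kball_zero_closed R).measurableSet).2
      (integrableOn_const (Kball_zero_compact R).measure_lt_top.ne)
  constructor
  · rw [← integral_indicator_one (Kball_zero_closed _).measurableSet]
    refine integral_mono (hI _) hi fun p => ?_
    by_cases hp : p ∈ Kball 0 (ρ / 2)
    · simp [hp, bump_one hρ p hp]
    · simp [hp, bump_nonneg]
  · rw [← integral_indicator_one (Kball_zero_closed _).measurableSet]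
    refine integral_mono hi (hI _) fun p => ?_
    by_cases hp : p ∈ Kball 0 ρ
    · simp [hp, bump_le_one]
    · simp [hp, bump_supp hρ p hp]

theorem exists_Kball_pos (ν : Measure (H n)) [IsFiniteMeasureOnCompacts ν] (h : ν ≠ 0) :
    ∃ R, 0 < R ∧ 0 < ν.real (Kball 0 R) := by
  by_contra! hcon
  apply h
  rw [← Measure.measure_univ_eq_zero]
  have hu : (Set.univ : Set (H n)) = ⋃ m : ℕ, Kball 0 ((m : ℝ) + 1) := by
    refine (Set.eq_univ_of_forall fun p => ?_).symm
    obtain ⟨m, hm⟩ := exists_nat_ge (Kgauge p)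
    exact Set.mem_iUnion.2 ⟨m, mem_Kball_zero.2 (by linarith)⟩
  rw [hu, measure_iUnion_null_iff]
  intro m
  have h1 := le_antisymm (hcon ((m : ℝ) + 1) (by positivity)) measureReal_nonneg
  exact (measureReal_eq_zero_iff (Kball_zero_compact _).measure_lt_top.ne).1 h1

theorem density_bounds (μ : Measure (H n)) [IsFiniteMeasureOnCompacts μ] (s : ℝ) (p : H n)
    (h0 : 0 < Filter.liminf (fun r : ℝ => μ (Kball p r) / ENNReal.ofReal (r ^ s)) (𝓝[>] 0))
    (h1 : Filter.limsup (fun r : ℝ => μ (Kball p r) / ENNReal.ofReal (r ^ s)) (𝓝[>] 0) < ⊤) :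
    ∃ b C : ℝ, 0 < b ∧ 0 < C ∧ ∀ᶠ r : ℝ in 𝓝[>] 0,
      b * r ^ s ≤ μ.real (Kball p r) ∧ μ.real (Kball p r) ≤ C * r ^ s := by
  obtain ⟨b, hb0, hb⟩ := exists_between h0
  obtain ⟨C, hC0, hC⟩ := exists_between h1
  have hbt : b ≠ ⊤ := by
    rintro rfl
    exact not_top_lt hb
  refine ⟨b.toReal, C.toReal, ENNReal.toReal_pos hb0.ne' hbt,
    ENNReal.toReal_pos (bot_le.trans_lt hC0).ne' hC.ne, ?_⟩
  filter_upwards [eventually_lt_of_lt_liminf hb, eventually_lt_of_limsup_lt hC0,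
    self_mem_nhdsWithin] with r h2 h3 hr
  have hr' : (0 : ℝ) < r := hr
  have hrs : 0 < r ^ s := Real.rpow_pos_of_pos hr' s
  have hx : (μ (Kball p r) / ENNReal.ofReal (r ^ s)).toReal = μ.real (Kball p r) / r ^ s := by
    rw [ENNReal.toReal_div, ENNReal.toReal_ofReal hrs.le, measureReal_def]
  have hxt : μ (Kball p r) / ENNReal.ofReal (r ^ s) ≠ ⊤ := (h3.trans hC).ne
  rw [← le_div_iff₀ hrs, ← div_le_iff₀ hrs, ← hx]
  exact ⟨ENNReal.toReal_mono hxt h2.le, ENNReal.toReal_mono hC.ne h3.le⟩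

theorem part_one (μ : Measure (H n)) [IsFiniteMeasureOnCompacts μ] (s : ℝ) (a : H n)
    {b C : ℝ} (hb : 0 < b) (hC : 0 < C) (hbC : ∀ᶠ r : ℝ in 𝓝[>] 0,
      b * r ^ s ≤ μ.real (Kball a r) ∧ μ.real (Kball a r) ≤ C * r ^ s)
    (ν : Measure (H n)) (hν : IsTangent μ a ν) : (0 : H n) ∈ msupport ν := by
  obtain ⟨hν0, hνf, c, r, hc, hr, hrt, hw⟩ := hν
  obtain ⟨R, hR, hRν⟩ := exists_Kball_pos ν hν0
  intro ρ hρ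
  have hsc : ∀ t : ℝ, 0 < t → Tendsto (fun i => t * r i) atTop (𝓝[>] 0) := fun t ht =>
    tendsto_nhdsWithin_iff.2 ⟨by simpa using hrt.const_mul t,
      Eventually.of_forall fun i => mul_pos ht (hr i)⟩
  have hfin : ∀ i, IsFiniteMeasureOnCompacts (resc μ a (c i) (r i)) := fun i => resc_fin μ a (hr i)
  set η := ν.real (Kball 0 R) / 2 with hη
  have hη0 : 0 < η := by positivity
  have hI : η < ∫ x, bump (2 * R) x ∂ν := by
    have h := (bump_bounds ν (ρ := 2 * R) (by positivity)).1
    rw [mul_div_cancel_left₀ R two_ne_zero] at h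
    linarith
  have e1 := (hw (bump (2 * R)) (bump_cont _) (bump_comp (by positivity))).eventually_const_lt hI
  have hP : 0 < (2 * R) ^ s := Real.rpow_pos_of_pos (by positivity) s
  have hQ : 0 < (ρ / 2) ^ s := Real.rpow_pos_of_pos (by positivity) s
  have hκ : 0 < b * (ρ / 2) ^ s * (η / (C * (2 * R) ^ s)) := by positivity
  have hlim : b * (ρ / 2) ^ s * (η / (C * (2 * R) ^ s)) ≤ ∫ x, bump ρ x ∂ν := by
    refine ge_of_tendsto (hw (bump ρ) (bump_cont _) (bump_comp hρ)) ?_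
    filter_upwards [e1, (hsc (2 * R) (by positivity)).eventually hbC,
      (hsc (ρ / 2) (by positivity)).eventually hbC] with i h1 h2 h3
    have hu := (bump_bounds (resc μ a (c i) (r i)) (ρ := 2 * R) (by positivity)).2
    rw [resc_Kball_real μ a (hc i).le (hr i)] at hu
    have hl := (bump_bounds (resc μ a (c i) (r i)) hρ).1
    rw [resc_Kball_real μ a (hc i).le (hr i)] at hl
    have h4 := h2.2
    have h5 := h3.1
    rw [Real.mul_rpow (by positivity) (hr i).le] at h4 h5
    change η < ∫ x, bump (2 * R) x ∂(resc μ a (c i) (r i)) at h1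
    change _ ≤ ∫ x, bump ρ x ∂(resc μ a (c i) (r i))
    refine le_trans ?_ hl
    have h6 : η ≤ c i * (C * ((2 * R) ^ s * r i ^ s)) :=
      (h1.le.trans hu).trans (mul_le_mul_of_nonneg_left h4 (hc i).le)
    have h7 : η / (C * (2 * R) ^ s) ≤ c i * r i ^ s := by
      rw [div_le_iff₀ (by positivity)]
      linarith
    calc b * (ρ / 2) ^ s * (η / (C * (2 * R) ^ s))
        ≤ b * (ρ / 2) ^ s * (c i * r i ^ s) := mul_le_mul_of_nonneg_left h7 (by positivity)
      _ = c i * (b * ((ρ / 2) ^ s * r i ^ s)) := by ring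
      _ ≤ _ := mul_le_mul_of_nonneg_left h5 (hc i).le
  have hfinal := lt_of_lt_of_le (hκ.trans_le hlim) (bump_bounds ν hρ).2
  exact (ENNReal.toReal_pos_iff.1 hfinal).1

theorem part_two (μ : Measure (H n)) [IsFiniteMeasureOnCompacts μ] (s : ℝ) (a : H n)
    {b C : ℝ} (hb : 0 < b) (hC : 0 < C) (hbC : ∀ᶠ r : ℝ in 𝓝[>] 0,
      b * r ^ s ≤ μ.real (Kball a r) ∧ μ.real (Kball a r) ≤ C * r ^ s)
    (r : ℕ → ℝ) (hr : ∀ k, 0 < r k) (hrt : Tendsto r atTop (𝓝 0)) :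
    ∃ φ : ℕ → ℕ, StrictMono φ ∧ ∃ c : ℝ, 0 < c ∧ ∃ ν : Measure (H n),
      IsTangent μ a ν ∧
      WeakTendsto (fun i => ENNReal.ofReal (c * (r (φ i)) ^ (-s)) •
        Measure.map (Tmap a (r (φ i))) μ) ν := by
  have hsc : ∀ t : ℝ, 0 < t → Tendsto (fun i => t * r i) atTop (𝓝[>] 0) := fun t ht =>
    tendsto_nhdsWithin_iff.2 ⟨by simpa using hrt.const_mul t,
      Eventually.of_forall fun i => mul_pos ht (hr i)⟩
  have hrs : ∀ k, 0 < r k ^ s := fun k => Real.rpow_pos_of_pos (hr k) s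
  have hc : ∀ k, 0 < 1 * r k ^ (-s) := fun k => by
    rw [one_mul]; exact Real.rpow_pos_of_pos (hr k) _
  have hcs : ∀ k, 1 * r k ^ (-s) * r k ^ s = 1 := fun k => by
    rw [one_mul, Real.rpow_neg (hr k).le, inv_mul_cancel₀ (hrs k).ne']
  have hfin : ∀ k, IsFiniteMeasureOnCompacts (resc μ a (1 * r k ^ (-s)) (r k)) :=
    fun k => resc_fin μ a (hr k)
  have hbound : ∀ m : ℕ, ∃ M : ℝ, ∀ k,
      (resc μ a (1 * r k ^ (-s)) (r k)).real (Metric.closedBall (0 : H n) m) ≤ M := by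
    intro m
    obtain ⟨R, hR⟩ := compact_subset_Kball (isCompact_closedBall (0 : H n) m)
    have hR' : Metric.closedBall (0 : H n) m ⊆ Kball 0 (max R 1) := fun p hp =>
      mem_Kball_zero.2 ((mem_Kball_zero.1 (hR hp)).trans (le_max_left _ _))
    have hpos : 0 < max R 1 := lt_max_of_lt_right one_pos
    have hev : ∀ᶠ k in atTop,
        (resc μ a (1 * r k ^ (-s)) (r k)).real (Kball (0 : H n) (max R 1))
          ≤ C * (max R 1) ^ s := by
      filter_upwards [(hsc _ hpos).eventually hbC] with k hk
      rw [resc_Kball_real μ a (hc k).le (hr k)]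
      have h4 := hk.2
      rw [Real.mul_rpow hpos.le (hr k).le] at h4
      calc _ ≤ _ := mul_le_mul_of_nonneg_left h4 (hc k).le
        _ = C * (max R 1) ^ s * (1 * r k ^ (-s) * r k ^ s) := by ring
        _ = _ := by rw [hcs, mul_one]
    obtain ⟨M, hM⟩ := (isBoundedUnder_of_eventually_le hev).bddAbove_range
    refine ⟨M, fun k => le_trans ?_ (hM ⟨k, rfl⟩)⟩
    exact measureReal_mono hR' (Kball_zero_compact _).measure_lt_top.ne
  obtain ⟨φ, hφ, ν, hνf, hν⟩ := vague_compactness (0 : H n)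
    (fun k => resc μ a (1 * r k ^ (-s)) (r k)) hbound
  refine ⟨φ, hφ, 1, one_pos, ν, ⟨?_, hνf, fun i => 1 * r (φ i) ^ (-s), fun i => r (φ i),
    fun i => hc _, fun i => hr _, hrt.comp hφ.tendsto_atTop, hν⟩, hν⟩
  rintro rfl
  have hlim : b ≤ ∫ x, bump 2 x ∂(0 : Measure (H n)) := by
    refine ge_of_tendsto (hν (bump 2) (bump_cont _) (bump_comp two_pos)) ?_
    filter_upwards [((hsc 1 one_pos).comp hφ.tendsto_atTop).eventually hbC] with i hi
    refine le_trans ?_ (bump_bounds (resc μ a (1 * r (φ i) ^ (-s)) (r (φ i))) two_pos).1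
    rw [resc_Kball_real μ a (hc _).le (hr _), div_self two_ne_zero]
    have h5 := hi.1
    simp only [Function.comp] at h5
    calc b = 1 * r (φ i) ^ (-s) * (b * (1 * r (φ i)) ^ s) := by
          rw [one_mul (r (φ i)), mul_left_comm, hcs, mul_one]
      _ ≤ _ := mul_le_mul_of_nonneg_left h5 (hc _).le
  simp only [integral_zero_measure] at hlim
  linarith

end Helpers

/-- Lemma 2.7: under two-sided density bounds, a.e. point has `0` in the
support of every tangent measure, and every scale sequence has a subsequence along which
`c · r_{k_i}^{-s} (T_{a,r_{k_i}})_# μ` converges to a tangent measure. -/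
theorem tangent_normalization (n : ℕ) (s : ℝ) (hs : 0 < s)
    (μ : Measure (H n)) [IsFiniteMeasureOnCompacts μ]
    (hdens : ∀ᵐ p ∂μ,
      0 < Filter.liminf (fun r : ℝ => μ (Kball p r) / ENNReal.ofReal (r ^ s)) (𝓝[>] 0) ∧
      Filter.liminf (fun r : ℝ => μ (Kball p r) / ENNReal.ofReal (r ^ s)) (𝓝[>] 0) ≤
        Filter.limsup (fun r : ℝ => μ (Kball p r) / ENNReal.ofReal (r ^ s)) (𝓝[>] 0) ∧
      Filter.limsup (fun r : ℝ => μ (Kball p r) / ENNReal.ofReal (r ^ s)) (𝓝[>] 0) < ⊤) :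
    ∀ᵐ a ∂μ,
      (∀ ν : Measure (H n), IsTangent μ a ν → (0 : H n) ∈ msupport ν) ∧
      (∀ r : ℕ → ℝ, (∀ k, 0 < r k) → Tendsto r atTop (𝓝 0) →
        ∃ φ : ℕ → ℕ, StrictMono φ ∧ ∃ c : ℝ, 0 < c ∧ ∃ ν : Measure (H n),
          IsTangent μ a ν ∧
          WeakTendsto
            (fun i => ENNReal.ofReal (c * (r (φ i)) ^ (-s)) •
              Measure.map (Tmap a (r (φ i))) μ) ν) := by
  filter_upwards [hdens] with a ha
  obtain ⟨b, C, hb, hC, hbC⟩ := density_bounds μ s a ha.1 ha.2.2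
  exact ⟨fun ν hν => part_one μ s a hb hC hbC ν hν,
    fun r hr hrt => part_two μ s a hb hC hbC r hr hrt⟩
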